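/- Strong continuity in H¹: Assume U ∈ C²(ℂ;ℝ), U(ψ) = u(|ψ|²), U(z) ≥ A − B|z|² (A ∈ ℝ, B > 0), and let ψ ∈ L^∞(ℝ, H¹(ℝ)) ∩ C_b(ℝ×ℝ;ℂ) be the solution of the Duhamel equation with data φ ∈ H¹(ℝ), with conserved charge and energy. Then the map t ↦ ψ(t) is continuous from ℝ to H¹(ℝ) with its norm topology: ‖ψ(t) − ψ(t₀)‖_{H¹} → 0 as t → t₀, for every t₀ ∈ ℝ. -/

import Mathlib

/-!  Common framework for the Schrödinger equation coupled to a nonlinear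
oscillator (point nonlinearity), following Komech–Komech.

The Sobolev space `H¹(ℝ)` is described through the Fourier side: an element
of `H¹(ℝ)` is (identified with) a measurable function `hat : ℝ → ℂ`
(its Fourier transform, nonunitary convention `φ̂(k) = ∫ e^{-ikx} φ(x) dx`)
such that `(1+k²)^{1/2} φ̂ ∈ L²(ℝ)`.  Since `φ̂ ∈ L¹`, the continuous
representative `φ(x) = (2π)⁻¹ ∫ e^{ikx} φ̂(k) dk` is defined pointwise, so
`φ(0)` makes sense.  Plancherel gives `‖φ‖²_{L²} = (2π)⁻¹∫|φ̂|²` and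
`‖φ'‖²_{L²} = (2π)⁻¹∫ k²|φ̂|²`. -/

noncomputable section

open MeasureTheory Real Set

namespace SNLS

/-- The Sobolev space `H¹(ℝ)`, described via the Fourier transform. -/
structure H1 : Type where
  hat : ℝ → ℂ
  meas : AEStronglyMeasurable hat (volume : Measure ℝ)
  finite : Integrable (fun k : ℝ => (1 + k ^ 2) * ‖hat k‖ ^ 2) volume

namespace H1

/-- The continuous (pointwise defined) representative of `φ ∈ H¹(ℝ)`:
the inverse Fourier transform, which converges absolutely. -/
def toFun (φ : H1) : ℝ → ℂ := fun x =>
  (2 * π)⁻¹ * ∫ k : ℝ, Complex.exp (Complex.I * ((k * x : ℝ) : ℂ)) * φ.hat k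

/-- `‖φ‖²_{L²} = ∫_ℝ |φ(x)|² dx`, computed on the Fourier side (Plancherel). -/
def l2NormSq (φ : H1) : ℝ := (2 * π)⁻¹ * ∫ k : ℝ, ‖φ.hat k‖ ^ 2

/-- `‖φ'‖²_{L²} = ∫_ℝ |φ'(x)|² dx`, computed on the Fourier side. -/
def derivL2NormSq (φ : H1) : ℝ := (2 * π)⁻¹ * ∫ k : ℝ, k ^ 2 * ‖φ.hat k‖ ^ 2

/-- `‖φ‖²_{H¹} = ‖φ‖²_{L²} + ‖φ'‖²_{L²}`. -/
def normSq (φ : H1) : ℝ := (2 * π)⁻¹ * ∫ k : ℝ, (1 + k ^ 2) * ‖φ.hat k‖ ^ 2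

/-- The `H¹` norm. -/
def norm (φ : H1) : ℝ := Real.sqrt φ.normSq

/-- The `H¹` distance. -/
def dist (φ ψ : H1) : ℝ :=
  Real.sqrt ((2 * π)⁻¹ * ∫ k : ℝ, (1 + k ^ 2) * ‖φ.hat k - ψ.hat k‖ ^ 2)

/-- The `H¹` inner product `⟨f,g⟩_{H¹} = ⟨f,g⟩_{L²} + ⟨f',g'⟩_{L²}`,
computed on the Fourier side. -/
def inner (φ ψ : H1) : ℂ :=
  (2 * π)⁻¹ * ∫ k : ℝ, ((1 + k ^ 2 : ℝ) : ℂ) * (starRingEnd ℂ (φ.hat k) * ψ.hat k)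

/-- Continuity of a curve in `H¹` on a set of times, w.r.t. the `H¹` distance. -/
def ContOn (Ψ : ℝ → H1) (S : Set ℝ) : Prop :=
  ∀ t₀ ∈ S, ∀ δ > 0, ∃ η > 0, ∀ t ∈ S, |t - t₀| < η → dist (Ψ t) (Ψ t₀) < δ

end H1

/-- The free Schrödinger group `W_t`, defined by `(W_tφ)^(k) = e^{ik²t} φ̂(k)`;
equivalently `(W_tφ)(x) = (2π)⁻¹ ∫ e^{ikx} e^{ik²t} φ̂(k) dk`. -/
def W (t : ℝ) (φ : H1) : ℝ → ℂ := fun x =>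
  (2 * π)⁻¹ * ∫ k : ℝ, Complex.exp (Complex.I * ((k * x + k ^ 2 * t : ℝ) : ℂ)) * φ.hat k

/-- The charge `Q(φ) = ½ ∫_ℝ |φ|² dx`. -/
def charge (φ : H1) : ℝ := (1 / 2) * φ.l2NormSq

/-- The energy `𝓗(φ) = ½ ∫_ℝ |φ'|² dx + U(φ(0))`. -/
def energy (U : ℂ → ℝ) (φ : H1) : ℝ := (1 / 2) * φ.derivL2NormSq + U (φ.toFun 0)

/-- The gradient `∇_ψ U` of `U : ℂ → ℝ` with respect to `(Re ψ, Im ψ)`,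
viewed as a complex number. -/
def grad (U : ℂ → ℝ) (z : ℂ) : ℂ :=
  ((fderiv ℝ U z 1 : ℝ) : ℂ) + ((fderiv ℝ U z Complex.I : ℝ) : ℂ) * Complex.I

/-- The nonlinearity `F(ψ) = -∇_ψ U(ψ)`. -/
def nonlin (U : ℂ → ℝ) (z : ℂ) : ℂ := -grad U z

/-- The kernel `(2πs)^{-1/2} e^{ix²/(2s)}` of the free propagator applied to
`δ(x)` (principal branch of the square root for negative times). -/
def freeKernel (s x : ℝ) : ℂ :=
  ((2 * π * s : ℝ) : ℂ) ^ (-(1 / 2 : ℂ)) *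
    Complex.exp (Complex.I * ((x ^ 2 : ℝ) : ℂ) / ((2 * s : ℝ) : ℂ))

/-- `ψ` solves, for all times in `S`, the Duhamel equation
`ψ(x,t) = W_tφ(x) − ∫_0^t (2πs)^{−1/2} e^{ix²/(2s)} F(ψ(0,t−s)) ds`
for the Schrödinger equation with point nonlinearity `F` and data `φ`. -/
def IsDuhamelSolution (F : ℂ → ℂ) (φ : H1) (ψ : ℝ → ℝ → ℂ) (S : Set ℝ) : Prop :=
  ∀ x : ℝ, ∀ t ∈ S,
    ψ x t = W t φ x - ∫ s in (0 : ℝ)..t, freeKernel s x * F (ψ 0 (t - s))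

/-- `ψ ∈ C_b(ℝ × S; ℂ)`: bounded and continuous on `ℝ × S`. -/
def CbOn (ψ : ℝ → ℝ → ℂ) (S : Set ℝ) : Prop :=
  ContinuousOn (fun p : ℝ × ℝ => ψ p.1 p.2) (Set.univ ×ˢ S) ∧
    ∃ M : ℝ, ∀ x : ℝ, ∀ t ∈ S, ‖ψ x t‖ ≤ M

/-- `t ↦ ψ(·,t)` takes values in `H¹(ℝ)` and is `H¹`-continuous on `S`. -/
def ContH1On (ψ : ℝ → ℝ → ℂ) (S : Set ℝ) : Prop :=
  ∃ Ψ : ℝ → H1, (∀ t ∈ S, ∀ x : ℝ, (Ψ t).toFun x = ψ x t) ∧ H1.ContOn Ψ S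

/-- A mollifying profile: `ρ₁ ∈ C₀^∞`, nonnegative, supported in `[-1,1]`,
of total integral `1`. -/
structure Mollifier : Type where
  ρ : ℝ → ℝ
  smooth : ContDiff ℝ (⊤ : ℕ∞) ρ
  supp : ∀ x : ℝ, x ∉ Set.Icc (-1 : ℝ) 1 → ρ x = 0
  nonneg : ∀ x : ℝ, 0 ≤ ρ x
  total : (∫ x : ℝ, ρ x) = 1

/-- `ρ_ε(x) = ε⁻¹ ρ₁(x/ε)`. -/
def rho (m : Mollifier) (ε : ℝ) : ℝ → ℝ := fun x => ε⁻¹ * m.ρ (x / ε)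

/-- The pairing `⟨g, ψ⟩ = ∫_ℝ g(x) ψ(x) dx`. -/
def pair (g : ℝ → ℝ) (ψ : ℝ → ℂ) : ℂ := ∫ x : ℝ, (g x : ℂ) * ψ x

/-- The `H¹` norm of an ordinary (smooth) function. -/
def h1NormFun (g : ℝ → ℝ) : ℝ :=
  Real.sqrt ((∫ x : ℝ, g x ^ 2) + ∫ x : ℝ, deriv g x ^ 2)

/-- The Fourier transform `ĝ(k) = ∫ e^{-ikx} g(x) dx` of a real function. -/
def fourierHatR (g : ℝ → ℝ) : ℝ → ℂ := fun k =>
  ∫ x : ℝ, Complex.exp (-(Complex.I * ((k * x : ℝ) : ℂ))) * (g x : ℂ)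

/-- The curve `Ψ : ℝ → H¹` solves, for times in `S`, the regularized Duhamel
equation `ψ_ε(t) = W_tφ − ∫_0^t W_s[ρ_ε · F(⟨ρ_ε, ψ_ε(t−s)⟩)] ds`
(with `g = ρ_ε`), written on the Fourier side, where it reads
`ψ̂_ε(t)(k) = e^{ik²t}φ̂(k) − ∫_0^t e^{ik²s} ĝ(k) F(⟨g, ψ_ε(t−s)⟩) ds`. -/
def IsRegularizedSolution (F : ℂ → ℂ) (g : ℝ → ℝ) (φ : H1) (Ψ : ℝ → H1)
    (S : Set ℝ) : Prop :=
  ∀ t ∈ S, ∀ k : ℝ,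
    (Ψ t).hat k =
      Complex.exp (Complex.I * ((k ^ 2 * t : ℝ) : ℂ)) * φ.hat k -
        ∫ s in (0 : ℝ)..t,
          Complex.exp (Complex.I * ((k ^ 2 * s : ℝ) : ℂ)) * fourierHatR g k *
            F (pair g (Ψ (t - s)).toFun)

/-- The regularized energy `𝓗_ε(ψ) = ½‖ψ'‖²_{L²} + U(⟨ρ_ε, ψ⟩)` (with `g = ρ_ε`). -/
def energyReg (U : ℂ → ℝ) (g : ℝ → ℝ) (φ : H1) : ℝ :=
  (1 / 2) * φ.derivL2NormSq + U (pair g φ.toFun)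

end SNLS
namespace SNLS

open scoped FourierTransform SchwartzMap InnerProductSpace in
lemma aux_hat_integrable (φ : H1) : Integrable φ.hat volume := by
  refine Integrable.mono' (g := fun k : ℝ => (1 + k ^ 2) * ‖φ.hat k‖ ^ 2 + (1 + k ^ 2)⁻¹)
    (φ.finite.add integrable_inv_one_add_sq) φ.meas (Filter.Eventually.of_forall fun k => ?_)
  have h : (0 : ℝ) < 1 + k ^ 2 := by positivity
  have e : (1 + k ^ 2) * (1 + k ^ 2)⁻¹ = 1 := mul_inv_cancel₀ h.ne'
  have hi : (0 : ℝ) < (1 + k ^ 2)⁻¹ := by positivity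
  have hn := norm_nonneg (φ.hat k)
  have h1 : 0 ≤ (1 + k ^ 2) * (‖φ.hat k‖ - (1 + k ^ 2)⁻¹) ^ 2 := by positivity
  have h2 : (1 + k ^ 2) * (‖φ.hat k‖ - (1 + k ^ 2)⁻¹) ^ 2 =
    (1 + k ^ 2) * ‖φ.hat k‖ ^ 2 - 2 * ‖φ.hat k‖ * ((1 + k ^ 2) * (1 + k ^ 2)⁻¹)
      + ((1 + k ^ 2) * (1 + k ^ 2)⁻¹) * (1 + k ^ 2)⁻¹ := by ring
  rw [e] at h2
  linarith

/-- Weighted conjugate of the Fourier transform. -/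
def auxV (φ : H1) : ℝ → ℂ := fun k => (1 + Complex.I * (k : ℂ)) * starRingEnd ℂ (φ.hat k)

lemma auxW_norm (k : ℝ) : ‖(1 + Complex.I * (k : ℂ))‖ ^ 2 = 1 + k ^ 2 := by
  rw [← Complex.normSq_eq_norm_sq, Complex.normSq_apply]
  simp
  ring

lemma auxV_norm (φ : H1) (k : ℝ) : ‖auxV φ k‖ ^ 2 = (1 + k ^ 2) * ‖φ.hat k‖ ^ 2 := by
  rw [auxV, norm_mul, mul_pow, auxW_norm]
  simp

lemma auxV_memLp (φ : H1) : MemLp (auxV φ) 2 volume := by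
  have hm : AEStronglyMeasurable (auxV φ) volume := by
    unfold auxV
    refine AEStronglyMeasurable.mul ?_ ?_
    · exact (by fun_prop : Continuous fun k : ℝ => (1 + Complex.I * (k : ℂ))).aestronglyMeasurable
    · exact Complex.continuous_conj.comp_aestronglyMeasurable φ.meas
  rw [memLp_two_iff_integrable_sq_norm hm]
  simp_rw [auxV_norm]
  exact φ.finite

lemma aux_norm_sq {f : ℝ → ℂ} (hf : MemLp f 2 volume) :
    ‖hf.toLp f‖ ^ 2 = ∫ k, ‖f k‖ ^ 2 := by
  have h := L2.inner_def (𝕜 := ℂ) (hf.toLp f) (hf.toLp f)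
  rw [inner_self_eq_norm_sq_to_K] at h
  have h2 : (∫ a, inner ℂ ((hf.toLp f : ℝ → ℂ) a) ((hf.toLp f : ℝ → ℂ) a))
      = ∫ a, ((‖f a‖ ^ 2 : ℝ) : ℂ) := by
    refine integral_congr_ae ?_
    filter_upwards [hf.coeFn_toLp] with a ha
    rw [ha, inner_self_eq_norm_sq_to_K]
    simp
  rw [h2, integral_complex_ofReal] at h
  exact Complex.ofReal_injective (by rw [← h]; push_cast; rfl)

lemma aux_dist (φ χ : H1) : H1.dist φ χ =
    Real.sqrt ((2 * π)⁻¹ * ‖(auxV_memLp φ).toLp _ - (auxV_memLp χ).toLp _‖ ^ 2) := by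
  rw [← MemLp.toLp_sub, aux_norm_sq, H1.dist]
  congr 2
  refine integral_congr_ae (Filter.Eventually.of_forall fun k => ?_)
  have : (auxV φ - auxV χ) k = (1 + Complex.I * (k : ℂ)) * starRingEnd ℂ (φ.hat k - χ.hat k) := by
    simp [auxV]; ring
  simp only [this, norm_mul, mul_pow, auxW_norm, RCLike.norm_conj]

lemma aux_normV (φ : H1) : ‖(auxV_memLp φ).toLp _‖ ^ 2 =
    2 * π * (φ.l2NormSq + φ.derivL2NormSq) := by
  rw [aux_norm_sq, H1.l2NormSq, H1.derivL2NormSq, ← mul_add, ← mul_assoc,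
    mul_inv_cancel₀ (by positivity), one_mul, ← integral_add]
  · refine integral_congr_ae (Filter.Eventually.of_forall fun k => ?_)
    simp only [auxV_norm]; ring
  · refine φ.finite.mono' (φ.meas.norm.pow 2) (Filter.Eventually.of_forall fun k => ?_)
    simp only [norm_pow, norm_norm]
    nlinarith [mul_nonneg (sq_nonneg k) (sq_nonneg ‖φ.hat k‖)]
  · refine φ.finite.mono' ?_ (Filter.Eventually.of_forall fun k => ?_)
    · exact (by fun_prop : Continuous fun k : ℝ => k ^ 2).aestronglyMeasurable.mul (φ.meas.norm.pow 2)
    · rw [Real.norm_of_nonneg (by positivity)]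
      nlinarith [sq_nonneg ‖φ.hat k‖]

open scoped FourierTransform SchwartzMap in
lemma aux_pair (φ : H1) (S : 𝓢(ℝ, ℂ)) :
    ∫ k, S k * φ.hat k = (2 * π) * ∫ ξ, (𝓕 S) ξ * φ.toFun (2 * π * ξ) := by
  have hS : ∀ k, S k = ∫ ξ, Complex.exp (Complex.I * ((k * (2 * π * ξ) : ℝ) : ℂ)) * (𝓕 S) ξ := by
    intro k
    have h1 : (𝓕⁻ (𝓕 S)) = S := by simp
    conv_lhs => rw [← h1]
    rw [SchwartzMap.fourierInv_coe, Real.fourierInv_eq']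
    refine integral_congr_ae (Filter.Eventually.of_forall fun ξ => ?_)
    simp only [smul_eq_mul]
    congr 2
    simp
    ring
  have hint : Integrable (Function.uncurry fun (k ξ : ℝ) =>
      Complex.exp (Complex.I * ((k * (2 * π * ξ) : ℝ) : ℂ)) * ((φ.hat k) * (𝓕 S) ξ))
      (volume.prod volume) := by
    have h0 := (aux_hat_integrable φ).mul_prod (SchwartzMap.integrable (𝓕 S) (μ := volume))
    refine h0.bdd_mul (c := 1) ?_ ?_
    · exact (by fun_prop : Continuous fun z : ℝ × ℝ =>
        Complex.exp (Complex.I * ((z.1 * (2 * π * z.2) : ℝ) : ℂ))).aestronglyMeasurable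
    · refine Filter.Eventually.of_forall fun z => ?_
      rw [mul_comm, Complex.norm_exp_ofReal_mul_I]
  calc ∫ k, S k * φ.hat k
      = ∫ k, ∫ ξ, Complex.exp (Complex.I * ((k * (2 * π * ξ) : ℝ) : ℂ)) * ((φ.hat k) * (𝓕 S) ξ) := by
        refine integral_congr_ae (Filter.Eventually.of_forall fun k => ?_)
        simp only
        rw [hS k, ← integral_mul_const]
        refine integral_congr_ae (Filter.Eventually.of_forall fun ξ => ?_)
        simp only
        ring
    _ = ∫ ξ, ∫ k, Complex.exp (Complex.I * ((k * (2 * π * ξ) : ℝ) : ℂ)) * ((φ.hat k) * (𝓕 S) ξ) :=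
        integral_integral_swap hint
    _ = _ := by
        rw [← integral_const_mul]
        refine integral_congr_ae (Filter.Eventually.of_forall fun ξ => ?_)
        simp only [H1.toFun]
        simp_rw [← mul_assoc]
        rw [integral_mul_const]
        have : (π : ℂ) ≠ 0 := by exact_mod_cast Real.pi_ne_zero
        have h2 : ((2 * π : ℝ) : ℂ) ≠ 0 := by exact_mod_cast (by positivity : (2 * π : ℝ) ≠ 0)
        generalize (∫ k, Complex.exp (Complex.I * ((k * 2 * π * ξ : ℝ) : ℂ)) * φ.hat k) = J
        push_cast
        field_simp

open scoped FourierTransform SchwartzMap in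
lemma aux_weak (ψ : ℝ → ℝ → ℂ) (Ψ : ℝ → H1) (hcb : CbOn ψ Set.univ)
    (hrep : ∀ t x : ℝ, (Ψ t).toFun x = ψ x t) (G : 𝓢(ℝ, ℂ)) (t₀ : ℝ) :
    Filter.Tendsto (fun t => inner ℂ ((auxV_memLp (Ψ t)).toLp _) (G.toLp 2)) (nhds t₀)
      (nhds (inner ℂ ((auxV_memLp (Ψ t₀)).toLp _) (G.toLp 2))) := by
  have hw : (fun k : ℝ => (1 - Complex.I * (k : ℂ))).HasTemperateGrowth := by fun_prop
  set S : 𝓢(ℝ, ℂ) := SchwartzMap.smulLeftCLM ℂ (fun k : ℝ => (1 - Complex.I * (k : ℂ))) G with hS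
  have key : ∀ t, inner ℂ ((auxV_memLp (Ψ t)).toLp _) (G.toLp 2) =
      (2 * π) * ∫ ξ, (𝓕 S) ξ * ψ (2 * π * ξ) t := by
    intro t
    simp_rw [← hrep]
    rw [← aux_pair, L2.inner_def]
    refine integral_congr_ae ?_
    filter_upwards [(auxV_memLp (Ψ t)).coeFn_toLp, G.coeFn_toLp 2 volume] with k h1 h2
    rw [h1, h2, hS, SchwartzMap.smulLeftCLM_apply_apply hw]
    simp [auxV]
    ring
  simp_rw [key]
  refine Filter.Tendsto.const_mul _ ?_
  obtain ⟨hc, M, hM⟩ := hcb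
  have hc' : Continuous (fun p : ℝ × ℝ => ψ p.1 p.2) := by
    rw [← continuousOn_univ]; simpa using hc
  refine tendsto_integral_filter_of_dominated_convergence (fun ξ => ‖(𝓕 S) ξ‖ * M) ?_ ?_ ?_ ?_
  · refine Filter.Eventually.of_forall fun t => ?_
    exact ((𝓕 S).continuous.mul
      (hc'.comp (by fun_prop : Continuous fun ξ : ℝ => (2 * π * ξ, t)))).aestronglyMeasurable
  · refine Filter.Eventually.of_forall fun t => Filter.Eventually.of_forall fun ξ => ?_
    rw [norm_mul]
    exact mul_le_mul_of_nonneg_left (hM _ _ (Set.mem_univ _)) (norm_nonneg _)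
  · exact (SchwartzMap.integrable (𝓕 S) (μ := volume)).norm.mul_const M
  · refine Filter.Eventually.of_forall fun ξ => ?_
    refine Filter.Tendsto.const_mul _ ?_
    exact (hc'.comp (by fun_prop : Continuous fun t : ℝ => (2 * π * ξ, t))).tendsto t₀

/-- Weak convergence against a dense set plus convergence of norms gives strong convergence. -/
lemma aux_strong {E : Type*} [NormedAddCommGroup E] [InnerProductSpace ℂ E]
    (v : ℝ → E) (t₀ : ℝ) (D : Set E) (hD : Dense D)
    (hn : Filter.Tendsto (fun t => ‖v t‖ ^ 2) (nhds t₀) (nhds (‖v t₀‖ ^ 2)))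
    (hw : ∀ g ∈ D, Filter.Tendsto (fun t => inner ℂ (v t) g) (nhds t₀)
      (nhds (inner ℂ (v t₀) g))) :
    Filter.Tendsto (fun t => ‖v t - v t₀‖ ^ 2) (nhds t₀) (nhds 0) := by
  rw [Metric.tendsto_nhds]
  intro ε hε
  obtain ⟨g, hg, hgd⟩ := Metric.dense_iff.1 hD (v t₀) (Real.sqrt (ε / 8)) (by positivity)
  rw [Metric.mem_ball, dist_eq_norm] at hg
  have hlim : Filter.Tendsto (fun t => ‖v t - g‖ ^ 2) (nhds t₀) (nhds (‖v t₀ - g‖ ^ 2)) := by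
    simp_rw [@norm_sub_sq ℂ]
    refine (hn.sub (Filter.Tendsto.const_mul 2 ?_)).add_const _
    exact (Complex.continuous_re.tendsto _).comp (hw g hgd)
  have hg2 : ‖v t₀ - g‖ ^ 2 < ε / 8 := by
    rw [norm_sub_rev] at hg
    have := pow_lt_pow_left₀ hg (norm_nonneg _) two_ne_zero
    rwa [Real.sq_sqrt (by positivity)] at this
  filter_upwards [hlim.eventually_lt_const hg2] with t ht
  rw [Real.dist_0_eq_abs, abs_of_nonneg (by positivity)]
  have h3 : ‖v t - v t₀‖ ≤ ‖v t - g‖ + ‖v t₀ - g‖ := by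
    rw [norm_sub_rev (v t₀) g]
    exact norm_sub_le_norm_sub_add_norm_sub _ _ _
  have := pow_le_pow_left₀ (norm_nonneg _) h3 2
  nlinarith [sq_nonneg (‖v t - g‖ - ‖v t₀ - g‖)]

/-- **Strong continuity in `H¹`.**
Let `ψ ∈ L^∞(ℝ, H¹(ℝ)) ∩ C_b(ℝ×ℝ;ℂ)` be the solution of the Duhamel equation
with data `φ`, with conserved charge and energy.  Then `t ↦ ψ(t)` is continuous
from `ℝ` to `H¹(ℝ)` with its norm topology:
`‖ψ(t) − ψ(t₀)‖_{H¹} → 0` as `t → t₀`, for every `t₀ ∈ ℝ`. -/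
theorem strong_continuity_H1
    (U : ℂ → ℝ) (u : ℝ → ℝ) (A B : ℝ)
    (hU : ContDiff ℝ 2 U)
    (hUinv : ∀ z : ℂ, U z = u (‖z‖ ^ 2))
    (hB : 0 < B)
    (hAB : ∀ z : ℂ, A - B * ‖z‖ ^ 2 ≤ U z)
    (φ : H1) (ψ : ℝ → ℝ → ℂ) (Ψ : ℝ → H1)
    (hcb : CbOn ψ Set.univ)
    (hsol : IsDuhamelSolution (nonlin U) φ ψ Set.univ)
    (hrep : ∀ t x : ℝ, (Ψ t).toFun x = ψ x t)
    (hbdd : ∃ M : ℝ, ∀ t : ℝ, H1.norm (Ψ t) ≤ M)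
    (hQ : ∀ t : ℝ, charge (Ψ t) = charge φ)
    (hH : ∀ t : ℝ, energy U (Ψ t) = energy U φ) :
    ∀ t₀ : ℝ,
      Filter.Tendsto (fun t : ℝ => H1.dist (Ψ t) (Ψ t₀)) (nhds t₀)
        (nhds 0) := by
  intro t₀
  have hstrong := aux_strong (fun t => (auxV_memLp (Ψ t)).toLp _) t₀
    (Set.range (SchwartzMap.toLpCLM ℂ (E := ℝ) ℂ 2 volume))
    (SchwartzMap.denseRange_toLpCLM (by simp)) ?_ ?_
  · simp_rw [aux_dist]
    have h := (Real.continuous_sqrt.tendsto _).comp (hstrong.const_mul (2 * π)⁻¹)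
    rw [mul_zero, Real.sqrt_zero] at h
    exact h
  · have hQ' : ∀ t, (Ψ t).l2NormSq = φ.l2NormSq := fun t => by
      have := hQ t
      simp only [charge] at this
      linarith
    have hH' : ∀ t, (Ψ t).derivL2NormSq = 2 * (energy U φ - U (ψ 0 t)) := fun t => by
      have := hH t
      rw [← hrep t 0]
      rw [← this, energy]
      ring
    simp_rw [aux_normV, hQ', hH']
    have hc' : Continuous (fun p : ℝ × ℝ => ψ p.1 p.2) := by
      rw [← continuousOn_univ]; simpa using hcb.1
    have hc2 : Continuous fun t => ψ 0 t :=
      hc'.comp (by fun_prop : Continuous fun t : ℝ => ((0 : ℝ), t))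
    have hc3 : Continuous fun t => U (ψ 0 t) := hU.continuous.comp hc2
    exact (by fun_prop : Continuous fun t =>
      2 * π * (φ.l2NormSq + 2 * (energy U φ - U (ψ 0 t)))).tendsto t₀
  · rintro _ ⟨G, rfl⟩
    exact aux_weak ψ Ψ hcb hrep G t₀


end SNLS
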